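/- Let E be a finite-dimensional real inner product space, ℓ : ℕ → E → ℝ with each ℓ_t twice continuously differentiable, f, μ : ℕ → ℝ with f t > 0 and μ t > 0, θ₀ ∈ E, and η₀ > 0. Define sequences θ_t ∈ E, η_t > 0, h_t ∈ E by h_0 = 0 and, for t ≥ 0: log η_{t+1} = log η_t + (1/μ t) · ⟨∇ℓ_t(θ_t), h_t⟩; h_{t+1} = h_t + (η_{t+1} / f t) • ∇ℓ_t(θ_t) + (η_{t+1} / f t) • (D(∇ℓ_t)(θ_t))(h_t); θ_{t+1} = θ_t + (η_{t+1} / f t) • ∇ℓ_t(θ_t). Define S : (ℕ → ℝ) → ℕ → E by S η 0 = θ₀ and S η (t+1) = S η t + (η(t+1)/f t) • ∇ℓ_t(S η t), and let η denote the sequence t ↦ η_t. Then for all t: S η t = θ_t, the map ε ↦ ℓ_t(S (s ↦ η_s · e^ε) t) is differentiable at 0 with derivative ⟨∇ℓ_t(θ_t), h_t⟩, and consequently log η_{t+1} = log η_t + (1/μ t) · (d/dε)|_{ε=0} ℓ_t(S (s ↦ η_s · e^ε) t). -/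

import Mathlib

open scoped RealInnerProductSpace

/-- The gradient of a twice continuously differentiable function is differentiable. -/
theorem ContDiff.differentiable_gradient {E : Type*} [NormedAddCommGroup E]
    [InnerProductSpace ℝ E] [CompleteSpace E] {g : E → ℝ} (hg : ContDiff ℝ 2 g) :
    Differentiable ℝ (gradient g) := by
  have hfderiv : Differentiable ℝ (fderiv ℝ g) :=
    (hg.fderiv_right (m := 1) (by norm_num)).differentiable one_ne_zero
  exact (InnerProductSpace.toDual ℝ E).symm.toContinuousLinearEquiv.differentiable.comp hfderiv

/-- in the SG/SG algorithm with exact Hessian, the step-size update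
is a genuine gradient ascent: the quantity `⟪∇ℓ_t(θ_t), h_t⟫` equals the
derivative of `ℓ_t` along the trajectory with respect to a simultaneous
multiplicative perturbation of all step sizes. -/
theorem sgsg_step_size_update_is_gradient_ascent
    {E : Type*} [NormedAddCommGroup E] [InnerProductSpace ℝ E] [FiniteDimensional ℝ E]
    (ℓ : ℕ → E → ℝ) (hℓ : ∀ t, ContDiff ℝ 2 (ℓ t))
    (f μ : ℕ → ℝ) (hf : ∀ t, 0 < f t) (hμ : ∀ t, 0 < μ t)
    (θ₀ : E)
    (θ : ℕ → E) (η : ℕ → ℝ) (h : ℕ → E)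
    (hθ0 : θ 0 = θ₀)
    (hη0 : 0 < η 0) (hηpos : ∀ t, 0 < η t)
    (hh0 : h 0 = 0)
    (hηrec : ∀ t, Real.log (η (t + 1))
      = Real.log (η t) + (1 / μ t) * ⟪gradient (ℓ t) (θ t), h t⟫)
    (hhrec : ∀ t, h (t + 1)
      = h t + (η (t + 1) / f t) • gradient (ℓ t) (θ t)
          + (η (t + 1) / f t) • (fderiv ℝ (gradient (ℓ t)) (θ t)) (h t))
    (hθrec : ∀ t, θ (t + 1) = θ t + (η (t + 1) / f t) • gradient (ℓ t) (θ t))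
    (S : (ℕ → ℝ) → ℕ → E)
    (hS0 : ∀ η', S η' 0 = θ₀)
    (hSrec : ∀ η' t, S η' (t + 1)
      = S η' t + (η' (t + 1) / f t) • gradient (ℓ t) (S η' t)) :
    ∀ t : ℕ,
      S η t = θ t ∧
      HasDerivAt (fun ε : ℝ => ℓ t (S (fun s => η s * Real.exp ε) t))
        ⟪gradient (ℓ t) (θ t), h t⟫ 0 ∧
      Real.log (η (t + 1))
        = Real.log (η t)
          + (1 / μ t) * deriv (fun ε : ℝ => ℓ t (S (fun s => η s * Real.exp ε) t)) 0 := by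
  have hS : ∀ t, S η t = θ t := by
    intro t
    induction t with
    | zero => rw [hS0, hθ0]
    | succ t ih => rw [hSrec, hθrec, ih]
  have hS' : ∀ t, S (fun s => η s * Real.exp 0) t = θ t := by simpa using hS
  have hexp (c : ℝ) : HasDerivAt (fun ε : ℝ => c * Real.exp ε) c 0 := by
    simpa using (Real.hasDerivAt_exp 0).const_mul c
  have hderiv : ∀ t, HasDerivAt (fun ε : ℝ => S (fun s => η s * Real.exp ε) t) (h t) 0 := by
    intro t
    induction t with
    | zero => simpa only [hS0, hh0] using hasDerivAt_const (0 : ℝ) θ₀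
    | succ t ih =>
      have hgrad : HasDerivAt (fun ε : ℝ => gradient (ℓ t) (S (fun s => η s * Real.exp ε) t))
          (fderiv ℝ (gradient (ℓ t)) (θ t) (h t)) 0 := by
        have hfd : HasFDerivAt (gradient (ℓ t)) (fderiv ℝ (gradient (ℓ t)) (θ t))
            (S (fun s => η s * Real.exp 0) t) := by
          rw [hS']
          exact ((hℓ t).differentiable_gradient (θ t)).hasFDerivAt
        exact hfd.comp_hasDerivAt (0 : ℝ) ih
      have hsum := ih.add (((hexp (η (t + 1))).div_const (f t)).smul hgrad)
      simp only [hSrec]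
      refine hsum.congr_deriv ?_
      rw [hhrec, hS', Real.exp_zero, mul_one]
      abel
  intro t
  have hloss : HasDerivAt (fun ε : ℝ => ℓ t (S (fun s => η s * Real.exp ε) t))
      ⟪gradient (ℓ t) (θ t), h t⟫ 0 := by
    have hfd : HasFDerivAt (ℓ t) (InnerProductSpace.toDual ℝ E (gradient (ℓ t) (θ t)))
        (S (fun s => η s * Real.exp 0) t) := by
      rw [hS']
      exact ((hℓ t).differentiable two_ne_zero (θ t)).hasGradientAt.hasFDerivAt
    exact hfd.comp_hasDerivAt (0 : ℝ) (hderiv t)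
  exact ⟨hS t, hloss, by rw [hloss.deriv, hηrec]⟩
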